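/- arXiv:2302.09666 — 5 statements merged into one kernel-verified Lean document; each statement's English description precedes it below -/
import Mathlib

section
/- Let A₁, …, A_k be canonical command sets. For each node n let I_n = { i : A_i contains a command on node n }, and, when all commands of ⋃ᵢ A_i on node n have the same input value, let x(n) denote this common value. Then A₁, …, A_k are jointly refluent if and only if: (a) for every node n, all commands of ⋃ᵢ A_i on n have the same input value; (b) if node m is strictly above node n and both I_n and I_m are nonempty, then I_{parent(n)} is nonempty; (c) for every non-root node n with I_{parent(n)} nonempty, if x(parent(n)) ≠ D then I_n ⊆ I_{parent(n)}; (d) for every non-root node n with I_n nonempty, if x(n) ≠ E then I_{parent(n)} ⊆ I_n. -/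
namespace FileSync

/-- A filesystem value: a directory, the empty value, or a file with content from `C`. -/
inductive Val (C : Type) : Type where
  | dir : Val C
  | empty : Val C
  | file : C → Val C

/-- The type of a value, ordered E < F < D via 0 < 1 < 2. -/
def vtype {C : Type} : Val C → ℕ
  | Val.empty => 0
  | Val.file _ => 1
  | Val.dir => 2

/-- A node is a nonempty finite sequence of names. -/
abbrev Node (N : Type) : Type := { l : List N // l ≠ ([] : List N) }

/-- `Anc m n`: `m` is a proper ancestor of (strictly above) `n`. -/
def Anc {N : Type} (m n : Node N) : Prop := m.1 <+: n.1 ∧ m ≠ n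

/-- Two nodes are comparable if one is a prefix of the other. -/
def NodesComparable {N : Type} (m n : Node N) : Prop := m.1 <+: n.1 ∨ n.1 <+: m.1

/-- `IsParent p n`: `p` is the parent of `n` (removing the last name of `n` gives `p`). -/
def IsParent {N : Type} (p n : Node N) : Prop := ∃ a : N, n.1 = p.1 ++ [a]

/-- A command: a node, an input value (precondition) and an output value. -/
structure Cmd (N C : Type) where
  node : Node N
  inp : Val C
  out : Val C

variable {N C : Type} [DecidableEq N]

/-- A valid filesystem: finitely many non-empty nodes, and the tree property. -/
def ValidFS (f : Node N → Val C) : Prop :=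
  {n : Node N | f n ≠ Val.empty}.Finite ∧
  ∀ n m : Node N, Anc m n → f n ≠ Val.empty → f m = Val.dir

/-- Replace the value at the node of `σ` by its output value. -/
def upd (f : Node N → Val C) (σ : Cmd N C) : Node N → Val C :=
  fun m => if m = σ.node then σ.out else f m

/-- `SeqOK α f`: the command sequence `α` does not break the filesystem `f`:
each command finds its input value and yields a valid filesystem. -/
def SeqOK : List (Cmd N C) → (Node N → Val C) → Prop
  | [], _ => True
  | σ :: rest, f => f σ.node = σ.inp ∧ ValidFS (upd f σ) ∧ SeqOK rest (upd f σ)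

/-- The result of applying a command sequence (left to right). -/
def applySeq : List (Cmd N C) → (Node N → Val C) → (Node N → Val C)
  | [], f => f
  | σ :: rest, f => applySeq rest (upd f σ)

/-- A sequence is non-breaking if there is at least one filesystem it does not break. -/
def NonBreaking (α : List (Cmd N C)) : Prop := ∃ f, ValidFS f ∧ SeqOK α f

/-- Semantic equivalence: on every filesystem both break, or both yield the same result. -/
def SeqEquiv (α β : List (Cmd N C)) : Prop :=
  ∀ f, ValidFS f → ((SeqOK α f ↔ SeqOK β f) ∧ (SeqOK α f → applySeq α f = applySeq β f))

/-- `SeqExt α β`: `β` semantically extends `α` (`α ≤ β`). -/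
def SeqExt (α β : List (Cmd N C)) : Prop :=
  ∀ f, ValidFS f → SeqOK α f → SeqOK β f ∧ applySeq β f = applySeq α f

/-- The `≪` relation between commands on child–parent or parent–child nodes. -/
def LL (σ τ : Cmd N C) : Prop :=
  (IsParent τ.node σ.node ∧ σ.out = Val.empty ∧ σ.inp ≠ Val.empty ∧
      τ.inp = Val.dir ∧ τ.out ≠ Val.dir) ∨
  (IsParent σ.node τ.node ∧ σ.out = Val.dir ∧ σ.inp ≠ Val.dir ∧
      τ.inp = Val.empty ∧ τ.out ≠ Val.empty)

/-- A canonical command set: finite, no null commands, at most one command per node,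
`≪`-connected (commands on distinct comparable nodes are joined by a `≪`-chain in the set). -/
def Canonical (A : Set (Cmd N C)) : Prop :=
  A.Finite ∧
  (∀ σ ∈ A, σ.inp ≠ σ.out) ∧
  (∀ σ ∈ A, ∀ τ ∈ A, σ.node = τ.node → σ = τ) ∧
  (∀ σ ∈ A, ∀ τ ∈ A, σ.node ≠ τ.node → NodesComparable σ.node τ.node →
    Relation.ReflTransGen (fun a b => a ∈ A ∧ b ∈ A ∧ LL a b) σ τ ∨
    Relation.ReflTransGen (fun a b => a ∈ A ∧ b ∈ A ∧ LL a b) τ σ)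

/-- A sequence honors `≪`: whenever `σ ≪ τ` for members, `σ` precedes `τ`. -/
def Honors (α : List (Cmd N C)) : Prop :=
  ∀ σ ∈ α, ∀ τ ∈ α, LL σ τ → List.Sublist [σ, τ] α

/-- A canonical sequence: its commands form a canonical set and it honors `≪`. -/
def CanonicalSeq (α : List (Cmd N C)) : Prop :=
  α.Nodup ∧ Canonical {σ : Cmd N C | σ ∈ α} ∧ Honors α

/-- `Orders A α`: the sequence `α` is an arrangement of the set `A` honoring `≪`. -/
def Orders (A : Set (Cmd N C)) (α : List (Cmd N C)) : Prop :=
  α.Nodup ∧ (∀ σ : Cmd N C, σ ∈ α ↔ σ ∈ A) ∧ Honors α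

/-- The action of a canonical set: `A` does not break `f`
(some `≪`-honoring arrangement exists, and every such arrangement works on `f`). -/
def SetNoBreak (A : Set (Cmd N C)) (f : Node N → Val C) : Prop :=
  (∃ α, Orders A α) ∧ ∀ α, Orders A α → SeqOK α f

/-- `SetApp A f g`: applying the set `A` (in any `≪`-honoring order) to `f` yields `g`. -/
def SetApp (A : Set (Cmd N C)) (f g : Node N → Val C) : Prop :=
  SetNoBreak A f ∧ ∀ α, Orders A α → applySeq α f = g

/-- The set `S` has a command on node `n`. -/
def Mentions (S : Set (Cmd N C)) (n : Node N) : Prop := ∃ ρ ∈ S, ρ.node = n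

/-- Two canonical sets are refluent if some filesystem is broken by neither. -/
def Refluent (A B : Set (Cmd N C)) : Prop :=
  ∃ f, ValidFS f ∧ SetNoBreak A f ∧ SetNoBreak B f

/-- Canonical sets are jointly refluent if a single filesystem is broken by none of them. -/
def JointlyRefluent {k : ℕ} (A : Fin k → Set (Cmd N C)) : Prop :=
  ∃ f, ValidFS f ∧ ∀ i, SetNoBreak (A i) f

/-- Two distinct commands are in conflict if they are on the same node, or one is on a
proper ancestor node, creates a non-directory, and the lower one creates non-empty content. -/
def Conflict (σ τ : Cmd N C) : Prop :=
  σ ≠ τ ∧ (σ.node = τ.node ∨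
    (Anc σ.node τ.node ∧ σ.out ≠ Val.dir ∧ τ.out ≠ Val.empty) ∨
    (Anc τ.node σ.node ∧ τ.out ≠ Val.dir ∧ σ.out ≠ Val.empty))

/-- A merger: a maximal canonical subset of `⋃ i, A i`. -/
def Merger {k : ℕ} (A : Fin k → Set (Cmd N C)) (M : Set (Cmd N C)) : Prop :=
  M ⊆ (⋃ i, A i) ∧ Canonical M ∧
  ∀ M' : Set (Cmd N C), M ⊆ M' → M' ⊆ (⋃ i, A i) → Canonical M' → M' = M

/-- `B` is an initial segment of `A`: there is an `≪`-honoring arrangement of `A` in which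
all commands of `B` precede all commands of `A \ B`. -/
def InitSeg (B A : Set (Cmd N C)) : Prop :=
  B ⊆ A ∧ ∃ α₁ α₂ : List (Cmd N C), Orders B α₁ ∧ Orders (A \ B) α₂ ∧ Orders A (α₁ ++ α₂)

/-- The inverse of a command. -/
def cinv (σ : Cmd N C) : Cmd N C := ⟨σ.node, σ.out, σ.inp⟩

/-- The inverse of a sequence: inverses of its commands in reverse order. -/
def seqInv (α : List (Cmd N C)) : List (Cmd N C) := (α.map cinv).reverse

section helpers

theorem IsParent.ne_node {p n : Node N} (h : IsParent p n) : p ≠ n := by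
  rintro rfl
  obtain ⟨a, ha⟩ := h
  have := congrArg List.length ha
  simp at this

theorem IsParent.asymm {p n : Node N} (h : IsParent p n) (h' : IsParent n p) : False := by
  obtain ⟨a, ha⟩ := h
  obtain ⟨b, hb⟩ := h'
  have h1 := congrArg List.length ha
  have h2 := congrArg List.length hb
  simp at h1 h2
  omega

theorem IsParent.anc {p n : Node N} (h : IsParent p n) : Anc p n := by
  refine ⟨?_, h.ne_node⟩
  obtain ⟨a, ha⟩ := h
  rw [ha]
  exact List.prefix_append _ _

/-- An ancestor of `n` is an ancestor-or-self of the parent of `n`. -/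
theorem Anc.exists_parent {m n : Node N} (h : Anc m n) :
    ∃ p, IsParent p n ∧ (m = p ∨ Anc m p) := by
  obtain ⟨⟨t, ht⟩, hne⟩ := h
  rcases List.eq_nil_or_concat t with rfl | ⟨t', a, rfl⟩
  · exfalso
    apply hne
    apply Subtype.ext
    simpa using ht
  · refine ⟨⟨m.1 ++ t', by simp [m.2]⟩, ⟨a, ?_⟩, ?_⟩
    · simp [← ht]
    · by_cases hm : m = ⟨m.1 ++ t', by simp [m.2]⟩
      · exact Or.inl hm
      · exact Or.inr ⟨List.prefix_append _ _, hm⟩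

/-- The child of `m` on the way to `n`. -/
theorem Anc.exists_child {m n : Node N} (h : Anc m n) :
    ∃ c, IsParent m c ∧ (c = n ∨ Anc c n) := by
  obtain ⟨⟨t, ht⟩, hne⟩ := h
  cases t with
  | nil =>
    exfalso
    apply hne
    apply Subtype.ext
    simpa using ht
  | cons a t' =>
    refine ⟨⟨m.1 ++ [a], by simp⟩, ⟨a, rfl⟩, ?_⟩
    by_cases hm : (⟨m.1 ++ [a], by simp⟩ : Node N) = n
    · exact Or.inl hm
    · refine Or.inr ⟨⟨t', ?_⟩, hm⟩
      simp [← ht]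

theorem Anc.length_lt {m n : Node N} (h : Anc m n) : m.1.length < n.1.length := by
  rcases lt_or_ge m.1.length n.1.length with h1 | h1
  · exact h1
  · exact absurd (Subtype.ext (h.1.eq_of_length_le h1)) h.2

theorem tree_of_local {f : Node N → Val C}
    (h : ∀ p n, IsParent p n → f n ≠ Val.empty → f p = Val.dir) :
    ∀ n m : Node N, Anc m n → f n ≠ Val.empty → f m = Val.dir := by
  intro n
  induction hl : n.1.length using Nat.strong_induction_on generalizing n with
  | _ l ih =>
    intro m hm hn
    obtain ⟨p, hp, hmp⟩ := hm.exists_parent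
    have hpd := h p n hp hn
    rcases hmp with rfl | hmp
    · exact hpd
    · exact ih p.1.length (hl ▸ hp.anc.length_lt) p rfl m hmp (by rw [hpd]; simp)

theorem between {M : Node N → Prop}
    (hb : ∀ n m p : Node N, Anc m n → IsParent p n → M n → M m → M p)
    {m x : Node N} (hm : M m) (hmx : Anc m x) :
    ∀ n : Node N, Anc x n → M n → M x := by
  intro n
  induction hl : n.1.length using Nat.strong_induction_on generalizing n with
  | _ l ih =>
    intro hxn hn
    obtain ⟨p, hp, hxp⟩ := hxn.exists_parent
    have hmn : Anc m n := by
      refine ⟨hmx.1.trans hxn.1, ?_⟩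
      rintro rfl
      have := hmx.length_lt
      have := hxn.length_lt
      omega
    have hpM := hb n m p hmn hp hn hm
    rcases hxp with rfl | hxp
    · exact hpM
    · exact ih p.1.length (hl ▸ hp.anc.length_lt) p rfl hxp hpM

theorem LL.irrefl {σ : Cmd N C} (h : LL σ σ) : False := by
  rcases h with h | h <;> exact h.1.ne_node rfl

theorem crossing {α : Type*} {R : α → α → Prop} (S : α → Prop) {a b : α}
    (h : Relation.ReflTransGen R a b) (ha : S a) (hb : ¬ S b) :
    ∃ c d, R c d ∧ S c ∧ ¬ S d := by
  induction h with
  | refl => exact absurd ha hb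
  | tail h1 h2 ih =>
    rename_i c d
    by_cases hc : S c
    · exact ⟨c, d, h2, hc, hb⟩
    · exact ih hc

theorem not_prefix_parent {p n q : Node N} (hp : IsParent p n) (h1 : q.1 <+: n.1)
    (h2 : ¬ q.1 <+: p.1) : q = n := by
  obtain ⟨a, ha⟩ := hp
  rw [ha, List.prefix_concat_iff] at h1
  rcases h1 with h1 | h1
  · exact Subtype.ext (h1.trans ha.symm)
  · exact absurd h1 h2

theorem IsParent.unique {p q n : Node N} (hp : IsParent p n) (hq : IsParent q n) : p = q := by
  obtain ⟨a, ha⟩ := hp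
  obtain ⟨b, hb⟩ := hq
  have := ha.symm.trans hb
  exact Subtype.ext (List.append_inj_left' this rfl)

theorem Canonical.direct {A : Set (Cmd N C)} (hA : Canonical A) {σ τ : Cmd N C}
    (hσ : σ ∈ A) (hτ : τ ∈ A) (hp : IsParent τ.node σ.node) : LL σ τ ∨ LL τ σ := by
  obtain ⟨-, -, huniq, hconn⟩ := hA
  have hS : ¬ σ.node.1 <+: τ.node.1 := by
    intro h
    have := h.length_le
    have := hp.anc.length_lt
    omega
  have key : ∀ c d : Cmd N C, c ∈ A → d ∈ A → (IsParent c.node d.node ∨ IsParent d.node c.node) →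
      σ.node.1 <+: c.node.1 → ¬ σ.node.1 <+: d.node.1 → c = σ ∧ d = τ := by
    intro c d hc hd hcd h1 h2
    rcases hcd with h | h
    · exact absurd (h1.trans h.anc.1) h2
    · have e := not_prefix_parent h h1 h2
      refine ⟨huniq c hc σ hσ e.symm, huniq d hd τ hτ ?_⟩
      rw [← e] at h
      exact h.unique hp
  rcases hconn σ hσ τ hτ hp.ne_node.symm (Or.inr hp.anc.1) with h | h
  · obtain ⟨c, d, ⟨hc, hd, hl⟩, h1, h2⟩ :=
      crossing (fun a : Cmd N C => σ.node.1 <+: a.node.1) h List.prefix_rfl hS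
    obtain ⟨rfl, rfl⟩ := key c d hc hd (by rcases hl with h | h; exacts [Or.inr h.1, Or.inl h.1]) h1 h2
    exact Or.inl hl
  · obtain ⟨c, d, ⟨hc, hd, hl⟩, h1, h2⟩ :=
      crossing (fun a : Cmd N C => ¬ σ.node.1 <+: a.node.1) h hS (not_not.2 List.prefix_rfl)
    obtain ⟨rfl, rfl⟩ := key d c hd hc (by rcases hl with h | h; exacts [Or.inl h.1, Or.inr h.1])
      (not_not.1 h2) h1
    exact Or.inr hl

/-- A sort key compatible with `≪`. -/
def key (σ : Cmd N C) : ℤ :=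
  if vtype σ.inp < vtype σ.out then (σ.node.1.length : ℤ) else -(σ.node.1.length : ℤ)

theorem LL.key_lt {σ τ : Cmd N C} (h : LL σ τ) : key σ < key τ := by
  rcases h with ⟨hp, h1, h2, h3, h4⟩ | ⟨hp, h1, h2, h3, h4⟩
  · have hl := hp.anc.length_lt
    have e1 : ¬ vtype σ.inp < vtype σ.out := by rw [h1]; simp [vtype]
    have e2 : ¬ vtype τ.inp < vtype τ.out := by
      rw [h3]
      cases τ.out <;> simp [vtype]
    simp only [key, e1, e2, if_false]
    omega
  · have hl := hp.anc.length_lt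
    have e1 : vtype σ.inp < vtype σ.out := by
      rw [h1]
      cases hh : σ.inp <;> simp_all [vtype]
    have e2 : vtype τ.inp < vtype τ.out := by
      rw [h3]
      cases hh : τ.out <;> simp_all [vtype]
    simp only [key, e1, e2, if_true]
    omega

theorem sublist_of_sorted {l : List (Cmd N C)}
    (hl : l.Pairwise (fun a b => key a ≤ key b)) :
    ∀ a ∈ l, ∀ b ∈ l, key a < key b → List.Sublist [a, b] l := by
  induction l with
  | nil => simp
  | cons c l ih =>
    intro a ha b hb hab
    rw [List.pairwise_cons] at hl
    rcases List.mem_cons.1 ha with rfl | ha'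
    · rcases List.mem_cons.1 hb with rfl | hb
      · exact absurd hab (lt_irrefl _)
      · exact List.Sublist.cons_cons _ (List.singleton_sublist.2 hb)
    · rcases List.mem_cons.1 hb with rfl | hb
      · exact absurd hab (not_lt.2 (hl.1 a ha'))
      · exact (ih hl.2 a ha' b hb hab).cons _

theorem exists_orders {A : Set (Cmd N C)} (hA : A.Finite) : ∃ α, Orders A α := by
  classical
  let r : Cmd N C → Cmd N C → Prop := fun a b => key a ≤ key b
  have : Std.Total r := ⟨fun a b => le_total (key a) (key b)⟩
  have : IsTrans (Cmd N C) r := ⟨fun a b c h1 h2 => le_trans (α := ℤ) h1 h2⟩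
  let l := hA.toFinset.toList.insertionSort r
  have hperm : l.Perm hA.toFinset.toList := List.perm_insertionSort r _
  refine ⟨l, hperm.nodup_iff.2 (Finset.nodup_toList _), ?_, ?_⟩
  · intro σ
    rw [hperm.mem_iff]
    simp
  · intro σ hσ τ hτ h
    exact sublist_of_sorted (List.pairwise_insertionSort r _) σ hσ τ hτ h.key_lt


theorem SeqOK.inp_eq {α : List (Cmd N C)} :
    ∀ {f : Node N → Val C}, SeqOK α f → α.Pairwise (fun a b => a.node ≠ b.node) →
      ∀ σ ∈ α, f σ.node = σ.inp := by
  induction α with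
  | nil => simp
  | cons c l ih =>
    intro f h hp σ hσ
    obtain ⟨h1, h2, h3⟩ := h
    rw [List.pairwise_cons] at hp
    rcases List.mem_cons.1 hσ with rfl | hσ
    · exact h1
    · have := ih h3 hp.2 σ hσ
      rw [← this]
      simp [upd, (hp.1 σ hσ).symm]

theorem SeqOK.after {α : List (Cmd N C)} :
    ∀ {f : Node N → Val C}, SeqOK α f → ∀ σ ∈ α,
      ∃ g : Node N → Val C, ValidFS g ∧ g σ.node = σ.out ∧
        ∀ n, (∀ τ ∈ α, τ.node ≠ n) → g n = f n := by
  induction α with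
  | nil => simp
  | cons c l ih =>
    intro f h σ hσ
    obtain ⟨h1, h2, h3⟩ := h
    rcases List.mem_cons.1 hσ with rfl | hσ
    · refine ⟨_, h2, by simp [upd], ?_⟩
      intro n hn
      simp [upd, (hn σ (by simp)).symm]
    · obtain ⟨g, hg1, hg2, hg3⟩ := ih h3 σ hσ
      refine ⟨g, hg1, hg2, ?_⟩
      intro n hn
      rw [hg3 n (fun τ hτ => hn τ (List.mem_cons_of_mem _ hτ))]
      simp [upd, (hn c (by simp)).symm]

theorem valid_upd {f : Node N → Val C} (hf : ValidFS f) {σ : Cmd N C}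
    (h1 : σ.out ≠ Val.empty → ∀ p, IsParent p σ.node → f p = Val.dir)
    (h2 : σ.out ≠ Val.dir → ∀ n, IsParent σ.node n → f n = Val.empty) :
    ValidFS (upd f σ) := by
  constructor
  · refine (hf.1.union (Set.finite_singleton σ.node)).subset ?_
    intro n hn
    by_cases h : n = σ.node
    · exact Or.inr h
    · left
      simpa [upd, h] using hn
  · apply tree_of_local
    intro p n hp hn
    by_cases hn' : n = σ.node
    · subst hn'
      have hpn := hp.ne_node
      simp only [upd, if_neg hpn, if_true] at hn ⊢
      exact h1 hn p hp
    · simp only [upd, if_neg hn'] at hn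
      by_cases hp' : p = σ.node
      · subst hp'
        simp only [upd, if_true]
        by_contra hd
        exact hn (h2 hd n hp)
      · simp only [upd, if_neg hp']
        exact hf.2 n p hp.anc hn

theorem seqOK_of {α : List (Cmd N C)} :
    ∀ {f : Node N → Val C}, ValidFS f → α.Pairwise (fun a b => a.node ≠ b.node) → Honors α →
      (∀ σ ∈ α, f σ.node = σ.inp) →
      (∀ σ ∈ α, σ.out ≠ Val.empty → ∀ p, IsParent p σ.node →
        (f p = Val.dir ∧ ∀ τ ∈ α, τ.node ≠ p) ∨ ∃ τ ∈ α, τ.node = p ∧ LL τ σ) →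
      (∀ σ ∈ α, σ.out ≠ Val.dir → ∀ n, IsParent σ.node n →
        (f n = Val.empty ∧ ∀ τ ∈ α, τ.node ≠ n) ∨ ∃ τ ∈ α, τ.node = n ∧ LL τ σ) →
      SeqOK α f := by
  induction α with
  | nil => intros; trivial
  | cons c l ih =>
    intro f hf hp hh hi h1 h2
    rw [List.pairwise_cons] at hp
    have hcl : c ∉ l := fun h => hp.1 c h rfl
    have hhead : ∀ τ ∈ c :: l, ¬ LL τ c := by
      intro τ hτ hL
      have hs := hh τ hτ c (by simp) hL
      cases hs with
      | cons _ hs => exact hcl (hs.subset (by simp))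
      | cons_cons _ hs => exact hL.irrefl
    have hval : ValidFS (upd f c) := by
      apply valid_upd hf
      · intro ho p hpp
        rcases h1 c (by simp) ho p hpp with h | ⟨τ, hτ, -, hL⟩
        · exact h.1
        · exact absurd hL (hhead τ hτ)
      · intro ho n hpn
        rcases h2 c (by simp) ho n hpn with h | ⟨τ, hτ, -, hL⟩
        · exact h.1
        · exact absurd hL (hhead τ hτ)
    refine ⟨hi c (by simp), hval, ih hval hp.2 ?_ ?_ ?_ ?_⟩
    · intro σ hσ τ hτ hL
      have hs := hh σ (List.mem_cons_of_mem _ hσ) τ (List.mem_cons_of_mem _ hτ) hL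
      cases hs with
      | cons _ hs => exact hs
      | cons_cons _ hs => exact absurd hσ hcl
    · intro σ hσ
      rw [← hi σ (List.mem_cons_of_mem _ hσ)]
      simp [upd, (hp.1 σ hσ).symm]
    · intro σ hσ ho p hpp
      rcases h1 σ (List.mem_cons_of_mem _ hσ) ho p hpp with h | ⟨τ, hτ, hτp, hL⟩
      · left
        refine ⟨?_, fun τ hτ => h.2 τ (List.mem_cons_of_mem _ hτ)⟩
        simp [upd, (h.2 c (by simp)).symm, h.1]
      · rcases List.mem_cons.1 hτ with rfl | hτ
        · left
          subst hτp
          refine ⟨?_, fun τ' hτ' => (hp.1 τ' hτ').symm⟩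
          simp only [upd, if_true]
          rcases hL with h | h
          · exact (h.1.asymm hpp).elim
          · exact h.2.1
        · exact Or.inr ⟨τ, hτ, hτp, hL⟩
    · intro σ hσ ho n hpn
      rcases h2 σ (List.mem_cons_of_mem _ hσ) ho n hpn with h | ⟨τ, hτ, hτp, hL⟩
      · left
        refine ⟨?_, fun τ hτ => h.2 τ (List.mem_cons_of_mem _ hτ)⟩
        simp [upd, (h.2 c (by simp)).symm, h.1]
      · rcases List.mem_cons.1 hτ with rfl | hτ
        · left
          subst hτp
          refine ⟨?_, fun τ' hτ' => (hp.1 τ' hτ').symm⟩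
          simp only [upd, if_true]
          rcases hL with h | h
          · exact h.2.1
          · exact (h.1.asymm hpn).elim
        · exact Or.inr ⟨τ, hτ, hτp, hL⟩

theorem Orders.pairwise {A : Set (Cmd N C)} (hA : Canonical A) {α : List (Cmd N C)}
    (h : Orders A α) : α.Pairwise (fun a b => a.node ≠ b.node) := by
  have := h.1
  refine List.Pairwise.imp_of_mem ?_ this
  intro a b ha hb hab he
  exact hab (hA.2.2.1 a ((h.2.1 a).1 ha) b ((h.2.1 b).1 hb) he)

theorem noBreak_inp {A : Set (Cmd N C)} (hA : Canonical A) {f : Node N → Val C}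
    (h : SetNoBreak A f) : ∀ σ ∈ A, f σ.node = σ.inp := by
  obtain ⟨⟨α, hα⟩, h⟩ := h
  intro σ hσ
  exact (h α hα).inp_eq (hα.pairwise hA) σ ((hα.2.1 σ).2 hσ)

theorem noBreak_after {A : Set (Cmd N C)} {f : Node N → Val C}
    (h : SetNoBreak A f) : ∀ σ ∈ A, ∃ g : Node N → Val C, ValidFS g ∧ g σ.node = σ.out ∧
        ∀ n, ¬ Mentions A n → g n = f n := by
  obtain ⟨⟨α, hα⟩, h⟩ := h
  intro σ hσ
  obtain ⟨g, h1, h2, h3⟩ := (h α hα).after σ ((hα.2.1 σ).2 hσ)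
  exact ⟨g, h1, h2, fun n hn => h3 n fun τ hτ he => hn ⟨τ, (hα.2.1 τ).1 hτ, he⟩⟩

/-- Creating something forces a modified or already present directory above. -/
theorem noBreak_up {A : Set (Cmd N C)} {f : Node N → Val C}
    (h : SetNoBreak A f) {σ : Cmd N C} (hσ : σ ∈ A) (ho : σ.out ≠ Val.empty)
    {p : Node N} (hp : Anc p σ.node) (hn : ¬ Mentions A p) : f p = Val.dir := by
  obtain ⟨g, h1, h2, h3⟩ := noBreak_after h σ hσ
  rw [← h3 p hn]
  exact h1.2 _ _ hp (by rwa [h2])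

theorem noBreak_down {A : Set (Cmd N C)} {f : Node N → Val C}
    (h : SetNoBreak A f) {σ : Cmd N C} (hσ : σ ∈ A) (ho : σ.out ≠ Val.dir)
    {n : Node N} (hp : Anc σ.node n) (hn : ¬ Mentions A n) : f n = Val.empty := by
  obtain ⟨g, h1, h2, h3⟩ := noBreak_after h σ hσ
  rw [← h3 n hn]
  by_contra hne
  exact ho (by rw [← h2]; exact h1.2 _ _ hp hne)

end helpers

theorem stmt_forward {N C : Type} [DecidableEq N] {k : ℕ} (A : Fin k → Set (Cmd N C))
    (hc : ∀ i, Canonical (A i)) (h : JointlyRefluent A) :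
      ((∀ σ τ : Cmd N C, (∃ i, σ ∈ A i) → (∃ i, τ ∈ A i) →
          σ.node = τ.node → σ.inp = τ.inp) ∧
       (∀ n m p : Node N, Anc m n → IsParent p n →
          (∃ i, Mentions (A i) n) → (∃ i, Mentions (A i) m) →
          ∃ i, Mentions (A i) p) ∧
       (∀ n p : Node N, IsParent p n →
          ∀ σ : Cmd N C, (∃ i, σ ∈ A i) → σ.node = p → σ.inp ≠ Val.dir →
            ∀ i, Mentions (A i) n → Mentions (A i) p) ∧
       (∀ n p : Node N, IsParent p n →
          ∀ σ : Cmd N C, (∃ i, σ ∈ A i) → σ.node = n → σ.inp ≠ Val.empty →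
            ∀ i, Mentions (A i) p → Mentions (A i) n)) := by
  obtain ⟨f, hf, hnb⟩ := h
  have hinp : ∀ i, ∀ σ ∈ A i, f σ.node = σ.inp := fun i => noBreak_inp (hc i) (hnb i)
  have hnn : ∀ i, ∀ σ ∈ A i, σ.inp ≠ σ.out := fun i => (hc i).2.1
  refine ⟨?_, ?_, ?_, ?_⟩
  · rintro σ τ ⟨i, hi⟩ ⟨j, hj⟩ he
    rw [← hinp i σ hi, ← hinp j τ hj, he]
  · rintro n m p hmn hp ⟨i, σ, hσ, rfl⟩ ⟨j, τ, hτ, rfl⟩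
    by_contra hno
    push Not at hno
    obtain ⟨q, hq, hmq⟩ := hmn.exists_parent
    obtain rfl := hq.unique hp
    rcases hmq with hmq | hmq
    · exact hno j ⟨τ, hτ, hmq⟩
    · have hfp : f q = Val.dir := by
        by_cases hx : σ.inp = Val.empty
        · apply noBreak_up (hnb i) hσ _ hp.anc (hno i)
          intro h
          exact hnn i σ hσ (hx.trans h.symm)
        · exact hf.2 _ _ hp.anc (by rwa [hinp i σ hσ])
      have hfm : f τ.node = Val.dir := hf.2 _ _ hmq (by rw [hfp]; simp)
      have hto : τ.out ≠ Val.dir := by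
        intro h
        exact hnn j τ hτ (by rw [← hinp j τ hτ, hfm, h])
      have := noBreak_down (hnb j) hτ hto hmq (hno j)
      rw [hfp] at this
      cases this
  · rintro n p hp σ ⟨j, hσ⟩ rfl hd i ⟨τ, hτ, rfl⟩
    by_contra hno
    have hfp : f σ.node ≠ Val.dir := by rwa [hinp j σ hσ]
    have hfn : f τ.node = Val.empty := by
      by_contra hne
      exact hfp (hf.2 _ _ hp.anc hne)
    apply hfp
    apply noBreak_up (hnb i) hτ _ hp.anc hno
    intro h
    exact hnn i τ hτ (by rw [← hinp i τ hτ, hfn, h])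
  · rintro n p hp σ ⟨j, hσ⟩ rfl hd i ⟨τ, hτ, rfl⟩
    by_contra hno
    have hfn : f σ.node ≠ Val.empty := by rwa [hinp j σ hσ]
    have hfp : f τ.node = Val.dir := hf.2 _ _ hp.anc hfn
    apply hfn
    apply noBreak_down (hnb i) hτ _ hp.anc hno
    intro h
    exact hnn i τ hτ (by rw [← hinp i τ hτ, hfp, h])

theorem stmt_backward {N C : Type} [DecidableEq N] {k : ℕ} (A : Fin k → Set (Cmd N C))
    (hc : ∀ i, Canonical (A i))
    (ha : ∀ σ τ : Cmd N C, (∃ i, σ ∈ A i) → (∃ i, τ ∈ A i) →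
          σ.node = τ.node → σ.inp = τ.inp)
    (hb : ∀ n m p : Node N, Anc m n → IsParent p n →
          (∃ i, Mentions (A i) n) → (∃ i, Mentions (A i) m) →
          ∃ i, Mentions (A i) p)
    (hcc : ∀ n p : Node N, IsParent p n →
          ∀ σ : Cmd N C, (∃ i, σ ∈ A i) → σ.node = p → σ.inp ≠ Val.dir →
            ∀ i, Mentions (A i) n → Mentions (A i) p)
    (hd : ∀ n p : Node N, IsParent p n →
          ∀ σ : Cmd N C, (∃ i, σ ∈ A i) → σ.node = n → σ.inp ≠ Val.empty →
            ∀ i, Mentions (A i) p → Mentions (A i) n) : JointlyRefluent A := by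
  classical
  let M : Node N → Prop := fun n => ∃ i, Mentions (A i) n
  have hbt : ∀ m x n : Node N, M m → Anc m x → Anc x n → M n → M x :=
    fun m x n hm hmx hxn hn => between (M := M) hb hm hmx n hxn hn
  obtain ⟨f, hf1, hf2, hf3⟩ : ∃ f : Node N → Val C,
      (∀ i, ∀ σ ∈ A i, f σ.node = σ.inp) ∧
      (∀ n, ¬ M n → (∃ n', Anc n n' ∧ M n') → f n = Val.dir) ∧
      (∀ n, ¬ M n → (¬ ∃ n', Anc n n' ∧ M n') → f n = Val.empty) := by
    refine ⟨fun n => if h : ∃ σ : Cmd N C, (∃ i, σ ∈ A i) ∧ σ.node = n then h.choose.inp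
      else if ∃ n', Anc n n' ∧ M n' then Val.dir else Val.empty, ?_, ?_, ?_⟩
    · intro i σ hσ
      have h : ∃ τ : Cmd N C, (∃ i, τ ∈ A i) ∧ τ.node = σ.node := ⟨σ, ⟨i, hσ⟩, rfl⟩
      simp only [dif_pos h]
      exact ha _ _ h.choose_spec.1 ⟨i, hσ⟩ h.choose_spec.2
    · intro n hn h
      have h' : ¬ ∃ τ : Cmd N C, (∃ i, τ ∈ A i) ∧ τ.node = n := by
        rintro ⟨τ, ⟨i, hi⟩, he⟩
        exact hn ⟨i, τ, hi, he⟩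
      simp only [dif_neg h', if_pos h]
    · intro n hn h
      have h' : ¬ ∃ τ : Cmd N C, (∃ i, τ ∈ A i) ∧ τ.node = n := by
        rintro ⟨τ, ⟨i, hi⟩, he⟩
        exact hn ⟨i, τ, hi, he⟩
      simp only [dif_neg h', if_neg h]
  have hval : ValidFS f := by
    constructor
    · have hfin : (⋃ i, A i).Finite := Set.finite_iUnion fun i => (hc i).1
      have hfin2 : (⋃ σ ∈ (⋃ i, A i), {n : Node N | n.1 <+: σ.node.1}).Finite := by
        refine hfin.biUnion ?_
        intro σ _
        have : ({l : List N | l <+: σ.node.1}).Finite := by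
          refine (List.finite_toSet σ.node.1.inits).subset ?_
          intro l hl
          exact (List.mem_inits l _).2 hl
        exact Set.Finite.preimage (f := fun n : Node N => n.1) Subtype.val_injective.injOn this
      refine hfin2.subset ?_
      intro n hn
      have : ∃ n', n.1 <+: n'.1 ∧ M n' := by
        by_contra hno
        push Not at hno
        have hM : ¬ M n := hno n List.prefix_rfl
        refine hn (hf3 n hM ?_)
        rintro ⟨n', h1, h2⟩
        exact hno n' h1.1 h2
      obtain ⟨n', h1, i, σ, hσ, rfl⟩ := this
      simp only [Set.mem_iUnion]
      exact ⟨σ, ⟨i, hσ⟩, h1⟩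
    · apply tree_of_local
      intro p n hp hn
      by_cases hMn : M n
      · by_cases hMp : M p
        · obtain ⟨i, σ, hσ, rfl⟩ := hMn
          obtain ⟨j, τ, hτ, rfl⟩ := hMp
          rw [hf1 i σ hσ] at hn
          rw [hf1 j τ hτ]
          by_contra hne
          obtain ⟨τ', hτ', he⟩ := hcc _ _ hp τ ⟨j, hτ⟩ rfl hne i ⟨σ, hσ, rfl⟩
          have hinp := ha τ' τ ⟨i, hτ'⟩ ⟨j, hτ⟩ he
          rw [← hinp] at hne
          rw [← he] at hp
          rcases (hc i).direct hσ hτ' hp with h | h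
          · rcases h with h | h
            · exact hne h.2.2.2.1
            · exact hp.asymm h.1
          · rcases h with h | h
            · exact hp.asymm h.1
            · exact hn h.2.2.2.1
        · exact hf2 p hMp ⟨n, hp.anc, hMn⟩
      · have hex : ∃ n', Anc n n' ∧ M n' := by
          by_contra hno
          exact hn (hf3 n hMn hno)
        obtain ⟨n', h1, h2⟩ := hex
        have hpn' : Anc p n' := by
          refine ⟨hp.anc.1.trans h1.1, ?_⟩
          rintro rfl
          have := hp.anc.length_lt
          have := h1.length_lt
          omega
        by_cases hMp : M p
        · exact absurd (hbt p n n' hMp hp.anc h1 h2) hMn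
        · exact hf2 p hMp ⟨n', hpn', h2⟩
  refine ⟨f, hval, fun i => ⟨exists_orders (hc i).1, ?_⟩⟩
  intro α hα
  have hmem := hα.2.1
  apply seqOK_of hval (hα.pairwise (hc i)) hα.2.2
  · intro σ hσ
    exact hf1 i σ ((hmem σ).1 hσ)
  · intro σ hσ ho p hp
    have hσA := (hmem σ).1 hσ
    by_cases hm : Mentions (A i) p
    · right
      obtain ⟨τ, hτ, rfl⟩ := hm
      refine ⟨τ, (hmem τ).2 hτ, rfl, ?_⟩
      rcases (hc i).direct hσA hτ hp with h | h
      · rcases h with h | h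
        · exact absurd h.2.1 ho
        · exact (hp.asymm h.1).elim
      · exact h
    · left
      refine ⟨?_, fun τ hτ he => hm ⟨τ, (hmem τ).1 hτ, he⟩⟩
      by_cases hMp : M p
      · obtain ⟨j, τ, hτ, rfl⟩ := hMp
        rw [hf1 j τ hτ]
        by_contra hne
        exact hm (hcc _ _ hp τ ⟨j, hτ⟩ rfl hne i ⟨σ, hσA, rfl⟩)
      · exact hf2 p hMp ⟨σ.node, hp.anc, i, σ, hσA, rfl⟩
  · intro σ hσ ho n hp
    have hσA := (hmem σ).1 hσ
    by_cases hm : Mentions (A i) n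
    · right
      obtain ⟨τ, hτ, rfl⟩ := hm
      refine ⟨τ, (hmem τ).2 hτ, rfl, ?_⟩
      rcases (hc i).direct hτ hσA hp with h | h
      · exact h
      · rcases h with h | h
        · exact (hp.asymm h.1).elim
        · exact absurd h.2.1 ho
    · left
      refine ⟨?_, fun τ hτ he => hm ⟨τ, (hmem τ).1 hτ, he⟩⟩
      by_cases hMn : M n
      · obtain ⟨j, τ, hτ, rfl⟩ := hMn
        rw [hf1 j τ hτ]
        by_contra hne
        exact hm (hd _ _ hp τ ⟨j, hτ⟩ rfl hne i ⟨σ, hσA, rfl⟩)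
      · refine hf3 n hMn ?_
        rintro ⟨n', h1, h2⟩
        exact hMn (hbt σ.node n n' ⟨i, σ, hσA, rfl⟩ hp.anc h1 h2)


/-- Canonical sets `A i` are jointly refluent iff (a) all commands on a node
share the input value; (b) if `m` is strictly above `n` and both nodes are mentioned, the
parent of `n` is mentioned; (c) if the common input at `parent n` is not `D` then
`I_n ⊆ I_{parent n}`; (d) if the common input at `n` is not `E` then `I_{parent n} ⊆ I_n`. -/
theorem stmt_9 {N C : Type} [DecidableEq N] {k : ℕ} (A : Fin k → Set (Cmd N C))
    (hc : ∀ i, Canonical (A i)) :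
    JointlyRefluent A ↔
      ((∀ σ τ : Cmd N C, (∃ i, σ ∈ A i) → (∃ i, τ ∈ A i) →
          σ.node = τ.node → σ.inp = τ.inp) ∧
       (∀ n m p : Node N, Anc m n → IsParent p n →
          (∃ i, Mentions (A i) n) → (∃ i, Mentions (A i) m) →
          ∃ i, Mentions (A i) p) ∧
       (∀ n p : Node N, IsParent p n →
          ∀ σ : Cmd N C, (∃ i, σ ∈ A i) → σ.node = p → σ.inp ≠ Val.dir →
            ∀ i, Mentions (A i) n → Mentions (A i) p) ∧
       (∀ n p : Node N, IsParent p n →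
          ∀ σ : Cmd N C, (∃ i, σ ∈ A i) → σ.node = n → σ.inp ≠ Val.empty →
            ∀ i, Mentions (A i) p → Mentions (A i) n)) := by
  exact ⟨stmt_forward A hc, fun ⟨ha, hb, hcc, hd⟩ => stmt_backward A hc ha hb hcc hd⟩

end FileSync
end

section
/- No two commands of a canonical command set are in conflict. -/
namespace FileSync

variable {N C : Type} [DecidableEq N]

theorem chain_aux {N C : Type} [DecidableEq N] (A : Set (Cmd N C)) (a b : Cmd N C)
    (h : Relation.ReflTransGen (fun a b => a ∈ A ∧ b ∈ A ∧ LL a b) a b) :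
    a = b ∨
    (a.out = Val.empty ∧ b.node.1.length < a.node.1.length ∧ b.out ≠ Val.dir) ∨
    (a.out = Val.dir ∧ a.node.1.length < b.node.1.length ∧ b.out ≠ Val.empty) := by
  induction h with
  | refl => exact Or.inl rfl
  | tail _ hbc ih =>
    obtain ⟨_, _, ⟨⟨x, hx⟩, h1, h2, h3, h4⟩ | ⟨⟨x, hx⟩, h1, h2, h3, h4⟩⟩ := hbc
    all_goals
      have hl := congrArg List.length hx
      simp only [List.length_append, List.length_singleton] at hl
    · rcases ih with rfl | ⟨i1, i2, i3⟩ | ⟨i1, i2, i3⟩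
      · exact Or.inr (Or.inl ⟨h1, by omega, h4⟩)
      · exact Or.inr (Or.inl ⟨i1, by omega, h4⟩)
      · exact absurd h1 i3
    · rcases ih with rfl | ⟨i1, i2, i3⟩ | ⟨i1, i2, i3⟩
      · exact Or.inr (Or.inr ⟨h1, by omega, h4⟩)
      · exact absurd h1 i3
      · exact Or.inr (Or.inr ⟨i1, by omega, h4⟩)

theorem no_conf_aux {N C : Type} [DecidableEq N] (A : Set (Cmd N C)) (hA : Canonical A)
    (σ τ : Cmd N C) (hσ : σ ∈ A) (hτ : τ ∈ A) (h : Anc σ.node τ.node)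
    (h1 : σ.out ≠ Val.dir) (h2 : τ.out ≠ Val.empty) : False := by
  have hle := h.1.length_le
  rcases hA.2.2.2 σ hσ τ hτ h.2 (Or.inl h.1) with hc | hc
  · rcases chain_aux A _ _ hc with e | ⟨_, i, _⟩ | ⟨i, _, _⟩
    · exact h.2 (congrArg Cmd.node e)
    · omega
    · exact h1 i
  · rcases chain_aux A _ _ hc with e | ⟨i, _, _⟩ | ⟨_, i, _⟩
    · exact h.2 (congrArg Cmd.node e.symm)
    · exact h2 i
    · omega

/-- No two commands of a canonical set are in conflict. -/
theorem stmt_10 {N C : Type} [DecidableEq N] (A : Set (Cmd N C)) (hA : Canonical A) :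
    ∀ σ ∈ A, ∀ τ ∈ A, ¬ Conflict σ τ := by 
  rintro σ hσ τ hτ ⟨hne, h | ⟨h, h1, h2⟩ | ⟨h, h1, h2⟩⟩
  · exact hne (hA.2.2.1 σ hσ τ hτ h)
  · exact no_conf_aux A hA σ τ hσ hτ h h1 h2
  · exact no_conf_aux A hA τ σ hτ hσ h h1 h2

end FileSync
end

section
/- If A is a canonical command set and B is an initial segment of A, then both B and A ∖ B are canonical command sets. -/
namespace FileSync

variable {N C : Type} [DecidableEq N]

theorem initSeg_down {N C : Type} (A B : Set (Cmd N C)) (h : InitSeg B A)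
    (a b : Cmd N C) (ha : a ∈ A) (hb : b ∈ B) (hl : LL a b) : a ∈ B := by
  obtain ⟨hBA, α₁, α₂, ⟨_, h1, _⟩, ⟨_, h2, _⟩, ⟨_, h3, h4⟩⟩ := h
  by_contra hn
  have hs := h4 a ((h3 a).2 ha) b ((h3 b).2 (hBA hb)) hl
  have hp : (α₁ ++ α₂).Pairwise (fun x y => ¬ (x ∉ B ∧ y ∈ B)) := by
    rw [List.pairwise_append]
    refine ⟨?_, ?_, ?_⟩
    · exact List.pairwise_of_forall_mem_list (fun x hx y _ hc => hc.1 ((h1 x).1 hx))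
    · exact List.pairwise_of_forall_mem_list (fun x _ y hy hc => ((h2 y).1 hy).2 hc.2)
    · exact fun x hx y _ hc => hc.1 ((h1 x).1 hx)
  have := hp.sublist hs
  simp at this
  exact this hn hb

theorem chain_down {N C : Type} (A B : Set (Cmd N C)) (h : InitSeg B A) (σ τ : Cmd N C)
    (hr : Relation.ReflTransGen (fun a b => a ∈ A ∧ b ∈ A ∧ LL a b) σ τ) (ht : τ ∈ B) :
    Relation.ReflTransGen (fun a b => a ∈ B ∧ b ∈ B ∧ LL a b) σ τ := by
  induction hr with
  | refl => exact .refl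
  | tail _ hbc ih =>
    have hb := initSeg_down A B h _ _ hbc.1 ht hbc.2.2
    exact (ih hb).tail ⟨hb, ht, hbc.2.2⟩

theorem chain_up {N C : Type} (A B : Set (Cmd N C)) (h : InitSeg B A) (σ τ : Cmd N C)
    (hr : Relation.ReflTransGen (fun a b => a ∈ A ∧ b ∈ A ∧ LL a b) σ τ) (hs : σ ∈ A \ B) :
    Relation.ReflTransGen (fun a b => a ∈ A \ B ∧ b ∈ A \ B ∧ LL a b) σ τ := by
  induction hr using Relation.ReflTransGen.head_induction_on with
  | refl => exact .refl
  | head hac _ ih =>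
    have hc : _ ∈ A \ B := ⟨hac.2.1, fun hb => hs.2 (initSeg_down A B h _ _ hac.1 hb hac.2.2)⟩
    exact .head ⟨hs, hc, hac.2.2⟩ (ih hc)

/-- If `B` is an initial segment of the canonical set `A`, then both `B`
and `A \ B` are canonical. -/
theorem stmt_14 {N C : Type} [DecidableEq N] (A B : Set (Cmd N C))
    (hA : Canonical A) (h : InitSeg B A) :
    Canonical B ∧ Canonical (A \ B) := by
  obtain ⟨hf, hn, hu, hc⟩ := hA
  have hB := h.1
  refine ⟨⟨hf.subset hB, fun σ hσ => hn σ (hB hσ),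
    fun σ hσ τ hτ => hu σ (hB hσ) τ (hB hτ), fun σ hσ τ hτ h1 h2 => ?_⟩,
    ⟨hf.subset Set.sdiff_subset, fun σ hσ => hn σ hσ.1,
    fun σ hσ τ hτ => hu σ hσ.1 τ hτ.1, fun σ hσ τ hτ h1 h2 => ?_⟩⟩
  · exact (hc σ (hB hσ) τ (hB hτ) h1 h2).imp (fun r => chain_down A B h _ _ r hτ)
      (fun r => chain_down A B h _ _ r hσ)
  · exact (hc σ hσ.1 τ hτ.1 h1 h2).imp (fun r => chain_up A B h _ _ r hσ)
      (fun r => chain_up A B h _ _ r hτ)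

end FileSync
end

section
/- If σ and τ are commands on two distinct nodes neither of which is the parent of the other, then σ and τ commute: the two-command sequence στ is semantically equivalent to τσ. -/
namespace FileSync

variable {N C : Type} [DecidableEq N]

theorem exists_between {N : Type} (a b : Node N) (h : Anc a b) (hp : ¬ IsParent a b) :
    ∃ k, Anc a k ∧ Anc k b := by
  obtain ⟨a, ha⟩ := a
  obtain ⟨b, hb⟩ := b
  obtain ⟨⟨t, ht⟩, hn⟩ := h
  simp only at ht
  subst ht
  rcases t with _ | ⟨x, _ | ⟨y, t⟩⟩
  · simp at hn
  · exact absurd ⟨x, rfl⟩ hp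
  · refine ⟨⟨a ++ [x], by simp⟩, ⟨⟨[x], rfl⟩, ?_⟩, ⟨⟨y :: t, by simp⟩, ?_⟩⟩ <;>
    · intro h
      have := congrArg (fun z : Node N => z.1.length) h
      simp at this

theorem valid_swap {N C : Type} [DecidableEq N] (σ τ : Cmd N C) (f : Node N → Val C)
    (hne : σ.node ≠ τ.node)
    (h1 : ¬ IsParent σ.node τ.node) (h2 : ¬ IsParent τ.node σ.node)
    (hf : ValidFS f) (hg : ValidFS (upd (upd f σ) τ)) : ValidFS (upd f τ) := by
  refine ⟨(hf.1.insert τ.node).subset ?_, ?_⟩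
  · intro n hn
    by_cases h : n = τ.node
    · exact Or.inl h
    · right
      simpa [upd, h] using hn
  · intro n m hmn hn
    by_cases hnt : n = τ.node
    · subst hnt
      have hmt : m ≠ τ.node := hmn.2
      have hout : upd (upd f σ) τ τ.node ≠ Val.empty := by simpa [upd] using hn
      by_cases hms : m = σ.node
      · subst hms
        obtain ⟨k, hk1, hk2⟩ := exists_between _ _ hmn h1
        have hk := hg.2 _ _ hk2 hout
        have hks : k ≠ σ.node := fun h => hk1.2 h.symm
        have hkt : k ≠ τ.node := hk2.2
        simp only [upd, hks, hkt, if_false] at hk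
        have := hf.2 _ _ hk1 (by simp [hk])
        simpa [upd, hne] using this
      · have := hg.2 _ _ hmn hout
        simpa [upd, hmt, hms] using this
    · have hfn : f n ≠ Val.empty := by simpa [upd, hnt] using hn
      by_cases hmt : m = τ.node
      · subst hmt
        have key : ∀ k, Anc τ.node k → k ≠ σ.node → f k ≠ Val.empty →
            upd f τ τ.node = Val.dir := by
          intro k hk hks hfk
          have hkt : k ≠ τ.node := fun h => hk.2 h.symm
          have := hg.2 _ _ hk (by simpa [upd, hks, hkt] using hfk)
          simpa [upd] using this
        by_cases hns : n = σ.node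
        · subst hns
          obtain ⟨k, hk1, hk2⟩ := exists_between _ _ hmn h2
          exact key k hk1 hk2.2 (by simp [hf.2 _ _ hk2 hfn])
        · exact key n hmn hns hfn
      · simpa [upd, hmt] using hf.2 _ _ hmn hfn

theorem upd_comm {N C : Type} [DecidableEq N] (σ τ : Cmd N C) (f : Node N → Val C)
    (hne : σ.node ≠ τ.node) : upd (upd f σ) τ = upd (upd f τ) σ := by
  funext m
  simp only [upd]
  split_ifs with h h' <;> first | rfl | exact absurd (h'.symm.trans h) hne

theorem seq_swap {N C : Type} [DecidableEq N] (σ τ : Cmd N C) (f : Node N → Val C)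
    (hne : σ.node ≠ τ.node)
    (h1 : ¬ IsParent σ.node τ.node) (h2 : ¬ IsParent τ.node σ.node)
    (hf : ValidFS f) (h : SeqOK [σ, τ] f) : SeqOK [τ, σ] f := by
  obtain ⟨ha, _, hb, hc, _⟩ := h
  refine ⟨?_, valid_swap σ τ f hne h1 h2 hf hc, ?_, ?_, trivial⟩
  · simpa [upd, hne.symm] using hb
  · simpa [upd, hne] using ha
  · rwa [← upd_comm σ τ f hne]

/-- Commands on distinct nodes, neither of which is the parent of the
other, commute. -/
theorem stmt_16 {N C : Type} [DecidableEq N] (σ τ : Cmd N C)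
    (hne : σ.node ≠ τ.node)
    (h1 : ¬ IsParent σ.node τ.node) (h2 : ¬ IsParent τ.node σ.node) :
    SeqEquiv [σ, τ] [τ, σ] := by
  intro f hf
  exact ⟨⟨seq_swap σ τ f hne h1 h2 hf, seq_swap τ σ f hne.symm h2 h1 hf⟩,
    fun _ => upd_comm σ τ f hne⟩

end FileSync
end

section
/- If σ and τ are non-null commands on nodes n and m where one of n, m is the parent of the other, then either the two-command sequence στ (σ applied first, then τ) breaks every filesystem, or σ ≪ τ. -/
namespace FileSync

variable {N C : Type} [DecidableEq N]

/-- The parent of a node is a proper ancestor. -/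
theorem anc_of_isParent {N : Type} {p n : Node N} (h : IsParent p n) : Anc p n := by
  obtain ⟨a, ha⟩ := h
  refine ⟨⟨[a], ha.symm⟩, ?_⟩
  intro e
  rw [e] at ha
  simpa using congrArg List.length ha

/-- For non-null commands on parent–child nodes, either `στ` breaks every
filesystem, or `σ ≪ τ`. -/
theorem stmt_17 {N C : Type} [DecidableEq N] (σ τ : Cmd N C)
    (hσ : σ.inp ≠ σ.out) (hτ : τ.inp ≠ τ.out)
    (h : IsParent σ.node τ.node ∨ IsParent τ.node σ.node) :
    (∀ f : Node N → Val C, ValidFS f → ¬ SeqOK [σ, τ] f) ∨ LL σ τ := by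
  by_contra hcon
  push Not at hcon
  obtain ⟨⟨f, hf, h1, hv1, h2, hv2, -⟩, hLL⟩ := hcon
  apply hLL
  rcases h with h | h
  · have ha := anc_of_isParent h
    have hne := ha.2
    have t0 := hf.2 _ _ ha
    have t1 := hv1.2 _ _ ha
    have t2 := hv2.2 _ _ ha
    simp only [upd, if_neg hne, if_neg hne.symm, if_true] at t1 t2 h2
    right
    grind
  · have ha := anc_of_isParent h
    have hne := ha.2
    have t0 := hf.2 _ _ ha
    have t1 := hv1.2 _ _ ha
    have t2 := hv2.2 _ _ ha
    simp only [upd, if_neg hne, if_neg hne.symm, if_true] at t1 t2 h2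
    left
    grind

end FileSync
end
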